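/- Let n ≥ 1, let f_1, …, f_n : ℝ^d → ℝ be differentiable convex functions whose gradients are L-Lipschitz (L > 0), let f = (1/n)∑_{i=1}^n f_i, assume f is μ-strongly convex for some μ > 0, and let x* be the minimizer of f. Let p ∈ (0, 1], set θ = (1/2)·min{ 1, √(μ/(pL)) } and η = (1 − θ)/( L·θ·(2 − θ) ), and define Φ(w, x) = f(w) − f(x*) + ((1 + μη)pθ/(2η))·‖x − x*‖². Fix x₀ ∈ ℝ^d, set w₀ = x₀, and for a sequence ω = ((i_0, b_0), …, (i_{T−1}, b_{T−1})) ∈ ({1,…,n} × {0,1})^T define recursively, for t = 0, …, T−1: u_t = θx_t + (1 − θ)w_t; g_t = ∇f_{i_t}(u_t) − ∇f_{i_t}(w_t) + ∇f(w_t); x_{t+1} = (1/(1 + μη))·(x_t + μη·u_t) − (η/(1 + μη))·g_t; w_{t+1} = θx_{t+1} + (1 − θ)w_t if b_t = 1 and w_{t+1} = w_t if b_t = 0. Then ∑_{ω ∈ ({1,…,n}×{0,1})^T} ( ∏_{t=0}^{T−1} (1/n)·p^{b_t}·(1 − p)^{1 − b_t} )·Φ(w_T(ω), x_T(ω)) ≤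 (1 − (4pθ)/5)^T · Φ(w₀, x₀). -/

import Mathlib

open scoped RealInnerProductSpace

section SmoothConvex

variable {E : Type*} [NormedAddCommGroup E] [InnerProductSpace ℝ E] [CompleteSpace E]
  {g : E → ℝ} {L : ℝ}

/-- The derivative of a differentiable function along a line. -/
lemma Differentiable.hasDerivAt_add_smul (hg : Differentiable ℝ g) (x v : E) (t : ℝ) :
    HasDerivAt (fun s : ℝ => g (x + s • v)) ⟪gradient g (x + t • v), v⟫ t := by
  have hline : HasDerivAt (fun s : ℝ => x + s • v) v t := by
    simpa using ((hasDerivAt_id t).smul_const v).const_add x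
  rw [inner_gradient_left]
  exact (hg (x + t • v)).hasFDerivAt.comp_hasDerivAt t hline

/-- The descent lemma for functions with Lipschitz gradient. -/
lemma Differentiable.le_add_inner_gradient_add_sq (hg : Differentiable ℝ g)
    (hlip : ∀ x y, ‖gradient g x - gradient g y‖ ≤ L * ‖x - y‖) (x y : E) :
    g y ≤ g x + ⟪gradient g x, y - x⟫ + L / 2 * ‖y - x‖ ^ 2 := by
  set v := y - x with hv
  have hd : ∀ t : ℝ, HasDerivAt
      (fun s : ℝ => g (x + s • v) - (s * ⟪gradient g x, v⟫ + L / 2 * ‖v‖ ^ 2 * s ^ 2))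
      (⟪gradient g (x + t • v), v⟫ - (⟪gradient g x, v⟫ + L * ‖v‖ ^ 2 * t)) t := by
    intro t
    refine (hg.hasDerivAt_add_smul x v t).sub ?_
    refine (((hasDerivAt_id t).mul_const ⟪gradient g x, v⟫).fun_add
      ((hasDerivAt_pow 2 t).const_mul (L / 2 * ‖v‖ ^ 2))).congr_deriv ?_
    push_cast
    ring
  have hanti := antitoneOn_of_deriv_nonpos (convex_Icc (0 : ℝ) 1)
    (fun t _ => (hd t).continuousAt.continuousWithinAt)
    (fun t _ => (hd t).differentiableAt.differentiableWithinAt) (fun t ht => by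
      rw [interior_Icc] at ht
      rw [(hd t).deriv]
      have h1 : ⟪gradient g (x + t • v) - gradient g x, v⟫ ≤ L * ‖v‖ ^ 2 * t := by
        calc _ ≤ ‖gradient g (x + t • v) - gradient g x‖ * ‖v‖ := real_inner_le_norm _ _
          _ ≤ (L * ‖x + t • v - x‖) * ‖v‖ := by gcongr; exact hlip _ _
          _ = _ := by
            rw [add_sub_cancel_left, norm_smul, Real.norm_of_nonneg ht.1.le]
            ring
      rw [inner_sub_left] at h1
      linarith)
  have h := hanti (Set.left_mem_Icc.2 zero_le_one) (Set.right_mem_Icc.2 zero_le_one) zero_le_one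
  simp only [one_smul, zero_smul, add_zero] at h
  rw [hv, add_sub_cancel] at h
  linarith

/-- A differentiable convex function lies above its tangent planes. -/
lemma ConvexOn.add_inner_gradient_le (hc : ConvexOn ℝ Set.univ g) (hg : Differentiable ℝ g)
    (x y : E) : g x + ⟪gradient g x, y - x⟫ ≤ g y := by
  have hline : ConvexOn ℝ Set.univ (fun s : ℝ => g (x + s • (y - x))) := by
    have := hc.comp_affineMap (AffineMap.lineMap x y : ℝ →ᵃ[ℝ] E)
    simpa [Function.comp_def, AffineMap.lineMap_apply, add_comm] using this
  have h := hline.le_slope_of_hasDerivAt (Set.mem_univ 0) (Set.mem_univ 1) zero_lt_one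
    (hg.hasDerivAt_add_smul x (y - x) 0)
  simp only [slope_def_field, zero_smul, one_smul, add_zero, add_sub_cancel, sub_zero,
    div_one] at h
  linarith

/-- Co-coercivity: the gradient variation of a smooth convex function is controlled by its
Bregman divergence. -/
lemma ConvexOn.norm_gradient_sub_sq_le (hL : 0 < L) (hc : ConvexOn ℝ Set.univ g)
    (hg : Differentiable ℝ g)
    (hlip : ∀ x y, ‖gradient g x - gradient g y‖ ≤ L * ‖x - y‖) (u w : E) :
    ‖gradient g u - gradient g w‖ ^ 2 ≤ 2 * L * (g w - g u - ⟪gradient g u, w - u⟫) := by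
  set e := gradient g u - gradient g w with he
  have h1 := hc.add_inner_gradient_le hg u (w + L⁻¹ • e)
  have h2 := hg.le_add_inner_gradient_add_sq hlip w (w + L⁻¹ • e)
  rw [add_sub_cancel_left, norm_smul, inner_smul_right, mul_pow, Real.norm_eq_abs, sq_abs] at h2
  rw [show w + L⁻¹ • e - u = (w - u) + L⁻¹ • e by abel, inner_add_right, inner_smul_right] at h1
  have h3 : ⟪gradient g u, e⟫ - ⟪gradient g w, e⟫ = ‖e‖ ^ 2 := by
    rw [← inner_sub_left, ← he, real_inner_self_eq_norm_sq]
  have h4 : L⁻¹ * ‖e‖ ^ 2 - L / 2 * (L⁻¹ ^ 2 * ‖e‖ ^ 2) = ‖e‖ ^ 2 / (2 * L) := by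
    field_simp
    ring
  have h5 : ‖e‖ ^ 2 / (2 * L) ≤ g w - g u - ⟪gradient g u, w - u⟫ := by
    have h6 := congrArg (L⁻¹ * ·) h3
    simp only [mul_sub] at h6
    rw [← h4]
    linarith
  rw [div_le_iff₀ (by positivity)] at h5
  linarith

/-- The gradient of a finite average is the average of the gradients. -/
lemma gradient_average {ι : Type*} [Fintype ι] {f : ι → E → ℝ}
    (hf : ∀ i, Differentiable ℝ (f i)) (c : ℝ) (x : E) :
    gradient (fun x => c * ∑ i, f i x) x = c • ∑ i, gradient (f i) x := by
  refine HasGradientAt.gradient ?_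
  rw [hasGradientAt_iff_hasFDerivAt, map_smulₛₗ, map_sum]
  simpa using (HasFDerivAt.fun_sum fun i _ => (hf i x).hasGradientAt.hasFDerivAt).const_mul c

end SmoothConvex

section Averages

variable {E : Type*} [NormedAddCommGroup E] [InnerProductSpace ℝ E] {ι : Type*} [Fintype ι]

/-- The sum of squared deviations from the mean is at most the sum of squares. -/
lemma sum_norm_sub_sq_le (a : ι → E) (m : E) (hm : ∑ i, a i = (Fintype.card ι : ℝ) • m) :
    ∑ i, ‖a i - m‖ ^ 2 ≤ ∑ i, ‖a i‖ ^ 2 := by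
  have h : ∑ i, ⟪a i, m⟫ = Fintype.card ι * ‖m‖ ^ 2 := by
    rw [← sum_inner, hm, real_inner_smul_left, real_inner_self_eq_norm_sq]
  simp only [norm_sub_sq_real, Finset.sum_add_distrib, Finset.sum_sub_distrib, ← Finset.mul_sum, h,
    Finset.sum_const, Finset.card_univ, nsmul_eq_mul]
  nlinarith [mul_nonneg (Nat.cast_nonneg (α := ℝ) (Fintype.card ι)) (sq_nonneg ‖m‖)]

end Averages

/-- Drift condition along a random recursion driven by independent inputs: a one-step
contraction in expectation iterates to a geometric bound. -/
lemma sum_prod_mul_le_pow_mul {A S : Type*} [Fintype A] (q : A → ℝ) (hq : ∀ a, 0 ≤ q a)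
    (step : S → A → S) (V : S → ℝ) {ρ : ℝ} (hρ : 0 ≤ ρ)
    (hV : ∀ z, ∑ a, q a * V (step z a) ≤ ρ * V z) (T : ℕ) (z₀ : S)
    (Z : (Fin T → A) → ℕ → S) (hZ0 : ∀ ω, Z ω 0 = z₀)
    (hZ : ∀ ω, ∀ t : Fin T, Z ω (t + 1) = step (Z ω t) (ω t)) :
    ∑ ω, (∏ t, q (ω t)) * V (Z ω T) ≤ ρ ^ T * V z₀ := by
  induction T generalizing z₀ with
  | zero => simp [hZ0]
  | succ T ih =>
    rw [← (Fin.consEquiv fun _ : Fin (T + 1) => A).sum_comp, Fintype.sum_prod_type]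
    calc _ = ∑ a, q a * ∑ ω : Fin T → A,
            (∏ t, q (ω t)) * V (Z (Fin.cons a ω : Fin (T + 1) → A) (T + 1)) := by
          simp [Fin.consEquiv, Fin.prod_univ_succ, Finset.mul_sum, mul_assoc]
      _ ≤ ∑ a, q a * (ρ ^ T * V (step z₀ a)) := by
          refine Finset.sum_le_sum fun a _ => mul_le_mul_of_nonneg_left ?_ (hq a)
          refine ih (step z₀ a) (fun ω t => Z (Fin.cons a ω : Fin (T + 1) → A) (t + 1)) ?_ ?_
          · intro ω
            simpa [hZ0] using hZ (Fin.cons a ω : Fin (T + 1) → A) 0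
          · intro ω t
            simpa using hZ (Fin.cons a ω : Fin (T + 1) → A) t.succ
      _ = ρ ^ T * ∑ a, q a * V (step z₀ a) := by
          rw [Finset.mul_sum]
          exact Finset.sum_congr rfl fun a _ => by ring
      _ ≤ ρ ^ T * (ρ * V z₀) := mul_le_mul_of_nonneg_left (hV z₀) (pow_nonneg hρ T)
      _ = _ := by ring

section Anita

variable {E : Type*} [NormedAddCommGroup E] [InnerProductSpace ℝ E]

/-- The three-point inequality for the proximal step defining the next `x`-iterate. -/
lemma prox_step_inner_le {a η : ℝ} (ha : 0 ≤ a) {x u y g : E}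
    (hy : (1 + a) • y = x + a • u - η • g) (z : E) :
    2 * (η * ⟪g, y - z⟫) ≤
      ‖x - z‖ ^ 2 - ‖y - x‖ ^ 2 + a * ‖u - z‖ ^ 2 - (1 + a) * ‖y - z‖ ^ 2 := by
  have hg : η • g = (x - y) + a • (u - y) := by
    rw [← sub_sub_cancel (x + a • u) (η • g), ← hy]
    module
  have h1 : ‖x - z‖ ^ 2 = ‖y - x‖ ^ 2 + 2 * ⟪x - y, y - z⟫ + ‖y - z‖ ^ 2 := by
    rw [← sub_add_sub_cancel x y z, norm_add_sq_real, norm_sub_rev x y]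
  have h2 : ‖u - z‖ ^ 2 = ‖u - y‖ ^ 2 + 2 * ⟪u - y, y - z⟫ + ‖y - z‖ ^ 2 := by
    rw [← sub_add_sub_cancel u y z, norm_add_sq_real]
  rw [← real_inner_smul_left, hg, inner_add_left, real_inner_smul_left, h1, h2]
  nlinarith [mul_nonneg ha (sq_nonneg ‖u - y‖)]

/-- A scaled Young inequality. -/
lemma neg_inner_le_young {c : ℝ} (hc : 0 < c) (a b : E) :
    -⟪a, b⟫ ≤ ‖a‖ ^ 2 / (2 * c) + c / 2 * ‖b‖ ^ 2 := by
  have h := neg_le_of_abs_le (abs_real_inner_le_norm a b)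
  have h2 : ‖a‖ ^ 2 / (2 * c) + c / 2 * ‖b‖ ^ 2 - ‖a‖ * ‖b‖ =
      (‖a‖ - c * ‖b‖) ^ 2 / (2 * c) := by
    field_simp
    ring
  have : 0 ≤ (‖a‖ - c * ‖b‖) ^ 2 / (2 * c) := by positivity
  linarith

/-- Progress of one step for a fixed sampled index, in terms of the noise `g - G` of the
gradient estimator `g` of `G = ∇F(u)`. -/
lemma anita_step_le {F : E → ℝ} {L μ θ η : ℝ} (hL : 0 < L) (hμ : 0 ≤ μ) (hθ : 0 < θ)
    (hθ1 : θ < 1) (hη : η = (1 - θ) / (L * θ * (2 - θ))) {x w u y g G : E}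
    (hu : u = θ • x + (1 - θ) • w)
    (hdesc : ∀ v, F v ≤ F u + ⟪G, v - u⟫ + L / 2 * ‖v - u‖ ^ 2)
    (hy : (1 + μ * η) • y = x + (μ * η) • u - η • g) (z : E) :
    F (θ • y + (1 - θ) • w) ≤ F u + θ * ⟪G, z - x⟫ + (1 - θ) / (2 * L) * ‖g - G‖ ^ 2
      + θ * ⟪g - G, z - x⟫ + θ / (2 * η) * ‖x - z‖ ^ 2 + θ * μ / 2 * ‖u - z‖ ^ 2
      - (1 + μ * η) * θ / (2 * η) * ‖y - z‖ ^ 2 := by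
  have h1θ : 0 < 1 - θ := by linarith
  have h2θ : 0 < 2 - θ := by linarith
  have hη0 : 0 < η := by rw [hη]; positivity
  have hprox := mul_le_mul_of_nonneg_left (prox_step_inner_le (mul_nonneg hμ hη0.le) hy z)
    (show 0 ≤ θ / (2 * η) by positivity)
  have hyoung := mul_le_mul_of_nonneg_left
    (neg_inner_le_young (show 0 < θ * L / (1 - θ) by positivity) (g - G) (y - x)) hθ.le
  have hd := hdesc (θ • y + (1 - θ) • w)
  have hv : θ • y + (1 - θ) • w - u = θ • (y - x) := by rw [hu]; module
  rw [hv, inner_smul_right, norm_smul, mul_pow, Real.norm_eq_abs, sq_abs] at hd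
  have hcoef : θ / (2 * η) = L / 2 * θ ^ 2 + θ * (θ * L / (1 - θ) / 2) := by
    rw [hη]
    field_simp
    ring
  have e1 : θ / (2 * η) * (2 * (η * ⟪g, y - z⟫)) = θ * ⟪g, y - z⟫ := by field_simp
  have e2 : θ * (‖g - G‖ ^ 2 / (2 * (θ * L / (1 - θ)))) = (1 - θ) / (2 * L) * ‖g - G‖ ^ 2 := by
    field_simp
  have e3 : θ / (2 * η) * (μ * η * ‖u - z‖ ^ 2) = θ * μ / 2 * ‖u - z‖ ^ 2 := by field_simp
  have e4 : (1 + μ * η) * θ / (2 * η) * ‖y - z‖ ^ 2 =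
      θ / (2 * η) * ((1 + μ * η) * ‖y - z‖ ^ 2) := by ring
  have e5 : θ / (2 * η) * ‖y - x‖ ^ 2 =
      L / 2 * θ ^ 2 * ‖y - x‖ ^ 2 + θ * (θ * L / (1 - θ) / 2 * ‖y - x‖ ^ 2) := by
    rw [hcoef]
    ring
  have e6 : ⟪G, y - x⟫ = ⟪g, y - z⟫ - ⟪g - G, y - x⟫ + ⟪g - G, z - x⟫ + ⟪G, z - x⟫ := by
    simp only [inner_sub_left, inner_sub_right]
    ring
  rw [e6] at hd
  linarith

/-- The expected progress of one step, over a uniformly sampled index. -/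
lemma anita_sum_step_le [CompleteSpace E] {n : ℕ} {f : Fin n → E → ℝ} (hn : 1 ≤ n) {L : ℝ}
    (hL : 0 < L) (hdiff : ∀ i, Differentiable ℝ (f i))
    (hconv : ∀ i, ConvexOn ℝ Set.univ (f i))
    (hlip : ∀ i x y, ‖gradient (f i) x - gradient (f i) y‖ ≤ L * ‖x - y‖)
    {F : E → ℝ} (hF : F = fun x => (1 / (n : ℝ)) * ∑ i, f i x) {μ : ℝ} (hμ : 0 ≤ μ)
    (hsc : ∀ x y, F x - F y - ⟪gradient F y, x - y⟫ ≥ (μ / 2) * ‖x - y‖ ^ 2)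
    {θ η : ℝ} (hθ : 0 < θ) (hθ1 : θ < 1) (hη : η = (1 - θ) / (L * θ * (2 - θ))) {x w u : E}
    (hu : u = θ • x + (1 - θ) • w) {y : Fin n → E}
    (hy : ∀ i, (1 + μ * η) • y i = x + (μ * η) • u
      - η • (gradient (f i) u - gradient (f i) w + gradient F w)) (z : E) :
    ∑ i, (F (θ • y i + (1 - θ) • w) - F z + (1 + μ * η) * θ / (2 * η) * ‖y i - z‖ ^ 2) ≤
      n * ((1 - θ) * (F w - F z) + θ / (2 * η) * ‖x - z‖ ^ 2) := by
  have hn0 : (0 : ℝ) < n := by exact_mod_cast hn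
  have hgrad : ∀ v, ∑ i, gradient (f i) v = (n : ℝ) • gradient F v := by
    intro v
    rw [hF, gradient_average hdiff, smul_smul, mul_one_div_cancel hn0.ne', one_smul]
  have hsum : ∀ v, ∑ i, f i v = n * F v := by
    intro v
    rw [hF]
    field_simp
  have hdesc : ∀ v, F v ≤ F u + ⟪gradient F u, v - u⟫ + L / 2 * ‖v - u‖ ^ 2 := by
    intro v
    have h := Finset.sum_le_sum fun i (_ : i ∈ Finset.univ) =>
      (hdiff i).le_add_inner_gradient_add_sq (hlip i) u v
    simp only [Finset.sum_add_distrib, ← sum_inner, hgrad, hsum, real_inner_smul_left,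
      Finset.sum_const, Finset.card_univ, Fintype.card_fin, nsmul_eq_mul, ← mul_add] at h
    exact le_of_mul_le_mul_left h hn0
  set δ : Fin n → E := fun i =>
    gradient (f i) u - gradient (f i) w + gradient F w - gradient F u with hδ
  have hδ0 : ∑ i, δ i = 0 := by
    simp only [hδ, Finset.sum_add_distrib, Finset.sum_sub_distrib, hgrad, Finset.sum_const,
      Finset.card_univ, Fintype.card_fin, ← Nat.cast_smul_eq_nsmul ℝ]
    abel
  have hvar : ∑ i, ‖δ i‖ ^ 2 ≤ n * (2 * L * (F w - F u - ⟪gradient F u, w - u⟫)) := by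
    have h1 := sum_norm_sub_sq_le (fun i => gradient (f i) u - gradient (f i) w)
      (gradient F u - gradient F w) (by
        rw [Finset.sum_sub_distrib, hgrad, hgrad, Fintype.card_fin, smul_sub])
    have h2 := Finset.sum_le_sum fun i (_ : i ∈ Finset.univ) =>
      (hconv i).norm_gradient_sub_sq_le hL (hdiff i) (hlip i) u w
    simp only [← Finset.mul_sum, Finset.sum_sub_distrib, ← sum_inner, hgrad, hsum,
      real_inner_smul_left] at h2
    calc _ = ∑ i, ‖gradient (f i) u - gradient (f i) w - (gradient F u - gradient F w)‖ ^ 2 := by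
          refine Finset.sum_congr rfl fun i _ => ?_
          simp only [hδ]
          congr 2
          abel
      _ ≤ _ := h1.trans h2
      _ = _ := by ring
  have hstep : ∑ i, _ ≤ ∑ i, (F u + θ * ⟪gradient F u, z - x⟫ + (1 - θ) / (2 * L) * ‖δ i‖ ^ 2
      + θ * ⟪δ i, z - x⟫ + θ / (2 * η) * ‖x - z‖ ^ 2 + θ * μ / 2 * ‖u - z‖ ^ 2
      - (1 + μ * η) * θ / (2 * η) * ‖y i - z‖ ^ 2 - F z) :=
    Finset.sum_le_sum fun i _ => sub_le_sub_right (anita_step_le hL hμ hθ hθ1 hη hu hdesc (hy i) z) (F z)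
  have hlin : ∑ i, ⟪δ i, z - x⟫ = 0 := by rw [← sum_inner, hδ0, inner_zero_left]
  have hvar' := mul_le_mul_of_nonneg_left hvar
    (show 0 ≤ (1 - θ) / (2 * L) from div_nonneg (by linarith) (by linarith))
  have e1 : (1 - θ) / (2 * L) * (n * (2 * L * (F w - F u - ⟪gradient F u, w - u⟫))) =
      n * ((1 - θ) * (F w - F u - ⟪gradient F u, w - u⟫)) := by field_simp
  have hcouple : θ * ⟪gradient F u, z - x⟫ =
      θ * ⟪gradient F u, z - u⟫ + (1 - θ) * ⟪gradient F u, w - u⟫ := by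
    rw [← real_inner_smul_right, ← real_inner_smul_right, ← real_inner_smul_right,
      ← inner_add_right]
    congr 1
    rw [hu]
    module
  have hsc' := mul_le_mul_of_nonneg_left (hsc z u) (mul_nonneg hn0.le hθ.le)
  rw [norm_sub_rev z u] at hsc'
  simp only [Finset.sum_add_distrib, Finset.sum_sub_distrib, ← Finset.mul_sum, hlin,
    Finset.sum_const, Finset.card_univ, Fintype.card_fin, nsmul_eq_mul, hcouple] at hstep ⊢
  rw [e1] at hvar'
  linarith

end Anita

/-- The step size makes the distance term of the potential contract. -/
lemma anita_contraction_factor {L μ p θ η : ℝ} (hL : 0 < L) (hp0 : 0 < p) (hp1 : p ≤ 1)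
    (hθ0 : 0 < θ) (hθ2 : θ ≤ 1 / 2) (hθμ : 4 * p * L * θ ^ 2 ≤ μ)
    (hη : η = (1 - θ) / (L * θ * (2 - θ))) :
    1 ≤ (1 - 4 * p * θ / 5) * (1 + μ * η) := by
  have h1θ : 0 < 1 - θ := by linarith
  have h2θ : 0 < 2 - θ := by linarith
  have hη0 : 0 < η := by rw [hη]; positivity
  have ha0 : 0 < p * θ := by positivity
  have ha : p * θ ≤ 1 / 2 := by nlinarith
  have hμη : 4 / 3 * (p * θ) ≤ μ * η := by
    refine le_trans ?_ (mul_le_mul_of_nonneg_right hθμ hη0.le)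
    have : 4 * p * L * θ ^ 2 * η = 4 * (p * θ) * ((1 - θ) / (2 - θ)) := by
      rw [hη]
      field_simp
    rw [this]
    have h3 : 1 / 3 ≤ (1 - θ) / (2 - θ) := by
      rw [div_le_div_iff₀ (by norm_num) h2θ]
      linarith
    nlinarith
  have := mul_le_mul_of_nonneg_left hμη (show 0 ≤ 1 - 4 * p * θ / 5 by nlinarith)
  nlinarith [mul_nonneg ha0.le (sub_nonneg.2 ha)]

/-- Theorem 2 of the paper (ANITA, strongly convex case): after `T` iterations,
`E[Φ_T] ≤ (1 − 4pθ/5)^T Φ_0`, with the expectation over the `T` independent uniform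
indices and Bernoulli(`p`) coins written as an explicit weighted sum over sample paths. -/
theorem anita_strongly_convex_linear_rate {d n : ℕ} (hn : 1 ≤ n)
    (f : Fin n → EuclideanSpace ℝ (Fin d) → ℝ) (L : ℝ) (hL : 0 < L)
    (hdiff : ∀ i, Differentiable ℝ (f i))
    (hconv : ∀ i, ConvexOn ℝ Set.univ (f i))
    (hlip : ∀ i x y, ‖gradient (f i) x - gradient (f i) y‖ ≤ L * ‖x - y‖)
    (F : EuclideanSpace ℝ (Fin d) → ℝ)
    (hF : F = fun x => (1 / (n : ℝ)) * ∑ i, f i x)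
    (μ : ℝ) (hμ : 0 < μ)
    (hsc : ∀ x y, F x - F y - ⟪gradient F y, x - y⟫ ≥ (μ / 2) * ‖x - y‖ ^ 2)
    (xstar : EuclideanSpace ℝ (Fin d)) (hmin : ∀ y, F xstar ≤ F y)
    (p : ℝ) (hp : p ∈ Set.Ioc (0 : ℝ) 1) (θ η : ℝ)
    (hθ : θ = (1 / 2) * min 1 (Real.sqrt (μ / (p * L))))
    (hη : η = (1 - θ) / (L * θ * (2 - θ)))
    (Φ : EuclideanSpace ℝ (Fin d) → EuclideanSpace ℝ (Fin d) → ℝ)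
    (hΦ : ∀ w x, Φ w x = F w - F xstar + ((1 + μ * η) * p * θ / (2 * η)) * ‖x - xstar‖ ^ 2)
    (x0 : EuclideanSpace ℝ (Fin d)) (T : ℕ)
    (X W : (Fin T → Fin n × Bool) → ℕ → EuclideanSpace ℝ (Fin d))
    (hX0 : ∀ ω, X ω 0 = x0) (hW0 : ∀ ω, W ω 0 = x0)
    (hXrec : ∀ ω, ∀ t : Fin T,
      X ω ((t : ℕ) + 1) =
        (1 / (1 + μ * η)) • (X ω t + (μ * η) • (θ • X ω t + (1 - θ) • W ω t))
          - (η / (1 + μ * η)) •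
              (gradient (f (ω t).1) (θ • X ω t + (1 - θ) • W ω t)
                - gradient (f (ω t).1) (W ω t) + gradient F (W ω t)))
    (hWrec : ∀ ω, ∀ t : Fin T,
      W ω ((t : ℕ) + 1) =
        if (ω t).2 then θ • X ω ((t : ℕ) + 1) + (1 - θ) • W ω t else W ω t) :
    ∑ ω : Fin T → Fin n × Bool,
        (∏ t : Fin T, (1 / (n : ℝ)) * (if (ω t).2 then p else 1 - p)) * Φ (W ω T) (X ω T) ≤
      (1 - 4 * p * θ / 5) ^ T * Φ x0 x0 := by
  obtain ⟨hp0, hp1⟩ := hp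
  have hθ0 : 0 < θ := by rw [hθ]; positivity
  have hθ2 : θ ≤ 1 / 2 := by
    rw [hθ]
    linarith [min_le_left 1 (Real.sqrt (μ / (p * L)))]
  have hθμ : 4 * p * L * θ ^ 2 ≤ μ := by
    have h1 : 2 * θ ≤ Real.sqrt (μ / (p * L)) := by
      rw [hθ]
      linarith [min_le_right 1 (Real.sqrt (μ / (p * L)))]
    have h2 := (Real.le_sqrt' (by positivity)).1 h1
    rw [le_div_iff₀ (by positivity)] at h2
    linarith
  have hη0 : 0 < η := by
    have : 0 < 1 - θ := by linarith
    have : 0 < 2 - θ := by linarith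
    rw [hη]
    positivity
  have hn0 : (0 : ℝ) < n := by exact_mod_cast hn
  have hfac := anita_contraction_factor hL hp0 hp1 hθ0 hθ2 hθμ hη
  have hone : 0 < 1 + μ * η := by positivity
  let xnext (s : EuclideanSpace ℝ (Fin d) × EuclideanSpace ℝ (Fin d)) (i : Fin n) :=
    (1 / (1 + μ * η)) • (s.1 + (μ * η) • (θ • s.1 + (1 - θ) • s.2))
      - (η / (1 + μ * η)) • (gradient (f i) (θ • s.1 + (1 - θ) • s.2)
        - gradient (f i) s.2 + gradient F s.2)
  let step (s : EuclideanSpace ℝ (Fin d) × EuclideanSpace ℝ (Fin d)) (a : Fin n × Bool) :=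
    (xnext s a.1, if a.2 then θ • xnext s a.1 + (1 - θ) • s.2 else s.2)
  refine sum_prod_mul_le_pow_mul (fun a : Fin n × Bool => (1 / (n : ℝ)) * if a.2 then p else 1 - p)
    (fun a => ?_) step (fun s => Φ s.2 s.1) (by nlinarith) (fun ⟨x, w⟩ => ?_) T (x0, x0)
    (fun ω t => (X ω t, W ω t)) (fun ω => by rw [hX0, hW0]) (fun ω t => ?_)
  · split_ifs
    · positivity
    · exact mul_nonneg (by positivity) (by linarith)
  · have hmain := anita_sum_step_le hn hL hdiff hconv hlip hF hμ.le hsc hθ0 (by linarith) hη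
      (x := x) (w := w) rfl (y := xnext (x, w)) (fun i => by
        simp only [xnext, smul_sub, smul_smul, mul_one_div_cancel hone.ne',
          mul_div_cancel₀ _ hone.ne', one_smul]) xstar
    set c := (1 + μ * η) * θ / (2 * η) with hc
    have hcp : (1 + μ * η) * p * θ / (2 * η) = p * c := by rw [hc]; ring
    have hsplit : ∑ a : Fin n × Bool,
        (1 / (n : ℝ) * if a.2 then p else 1 - p) * Φ (step (x, w) a).2 (step (x, w) a).1 =
        p / n * ∑ i, (F (θ • xnext (x, w) i + (1 - θ) • w) - F xstar
          + c * ‖xnext (x, w) i - xstar‖ ^ 2) + (1 - p) * (F w - F xstar) := by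
      have hconst : (1 - p) * (F w - F xstar) =
          ∑ _i : Fin n, (1 - p) / n * (F w - F xstar) := by
        rw [Finset.sum_const, Finset.card_univ, Fintype.card_fin, nsmul_eq_mul]
        field_simp
      rw [hconst, Finset.mul_sum, ← Finset.sum_add_distrib, Fintype.sum_prod_type]
      refine Finset.sum_congr rfl fun i _ => ?_
      simp only [Fintype.sum_bool, step, hΦ, hcp, if_true, Bool.false_eq_true, if_false]
      ring
    have hmain' := mul_le_mul_of_nonneg_left hmain (show 0 ≤ p / n by positivity)
    have e1 : p / n * (n * ((1 - θ) * (F w - F xstar) + θ / (2 * η) * ‖x - xstar‖ ^ 2)) =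
        p * (1 - θ) * (F w - F xstar) + p * θ / (2 * η) * ‖x - xstar‖ ^ 2 := by
      field_simp
    rw [e1] at hmain'
    rw [hsplit, hΦ]
    have hD : p * θ * (F w - F xstar) ≥ 4 * p * θ / 5 * (F w - F xstar) := by
      nlinarith [mul_nonneg (mul_nonneg hp0.le hθ0.le) (sub_nonneg.2 (hmin w))]
    have hdist : p * θ / (2 * η) * ‖x - xstar‖ ^ 2 ≤
        (1 - 4 * p * θ / 5) * ((1 + μ * η) * p * θ / (2 * η) * ‖x - xstar‖ ^ 2) := by
      have := mul_le_mul_of_nonneg_right hfac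
        (show 0 ≤ p * θ / (2 * η) * ‖x - xstar‖ ^ 2 by positivity)
      calc _ ≤ _ := (one_mul _).symm.le.trans this
        _ = _ := by ring
    linarith
  · simp only [step, xnext, Prod.mk.injEq]
    exact ⟨hXrec ω t, by rw [hWrec ω t, hXrec ω t]⟩
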